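/- Let n_c, n_t be positive natural numbers, let 𝟙 denote the all-ones column vector (of the indicated dimension), and let H = I_{n_t} − (1/n_t)·𝟙_{n_t}𝟙_{n_t}ᵀ be the centering matrix. Let X ∈ ℝ^{n_c × n_t} be a matrix each of whose columns sums to one, i.e. 𝟙_{n_c}ᵀ X = 𝟙_{n_t}ᵀ, and set X̄ = X H. Let U_d ∈ ℝ^{n_c × d} be a matrix with orthonormal columns (U_dᵀ U_d = I_d) such that every column of U_d lies in the column space of X̄ (the range of the linear map v ↦ X̄ v). Then the reconstructed matrix X̃ = U_d U_dᵀ X̄ + X (I_{n_t} − H) again has all column sums equal to one, i.e. 𝟙_{n_c}ᵀ X̃ = 𝟙_{n_t}ᵀ. -/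

import Mathlib

open Matrix BigOperators

/-- The all-ones row vector is annihilated by the centering matrix. -/
theorem one_vecMul_centering (n : ℕ) (hn : 0 < n) :
    (1 : Fin n → ℝ) ᵥ* ((1 : Matrix (Fin n) (Fin n) ℝ) -
      ((1 : ℝ) / (n : ℝ)) • Matrix.of (fun _ _ => (1 : ℝ))) = 0 := by
  have hn' : (n : ℝ) ≠ 0 := by positivity
  ext j
  simp [Matrix.vecMul, dotProduct, Matrix.one_apply, hn']

/-- A row vector annihilating `A` on the left annihilates every matrix whose columns lie in the
column space of `A`. -/
theorem vecMul_eq_zero_of_columns_mem_range {m n d : Type*} [Fintype m] [Fintype n]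
    {w : m → ℝ} {A : Matrix m n ℝ} {U : Matrix m d ℝ} (hA : w ᵥ* A = 0)
    (hU : ∀ k, ∃ v : n → ℝ, A *ᵥ v = fun i => U i k) : w ᵥ* U = 0 := by
  ext k
  obtain ⟨v, hv⟩ := hU k
  change w ⬝ᵥ (fun i => U i k) = 0
  rw [← hv, Matrix.dotProduct_mulVec, hA, zero_dotProduct]

/-- Proposition 1 (mass conservation of the POD reconstruction):
If every column of `X` sums to one, `H` is the centering matrix,
`U` has orthonormal columns each lying in the column space of `X̄ = X * H`,
then every column of the reconstruction `U * Uᵀ * (X * H) + X * (1 - H)` sums to one. -/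
theorem pod_reconstruction_conserves_mass
    (n_c n_t d : ℕ) (hnc : 0 < n_c) (hnt : 0 < n_t)
    (X : Matrix (Fin n_c) (Fin n_t) ℝ)
    (H : Matrix (Fin n_t) (Fin n_t) ℝ)
    (hH : H = 1 - ((1 : ℝ) / (n_t : ℝ)) • Matrix.of (fun _ _ => (1 : ℝ)))
    (hX : ∀ j, ∑ i, X i j = 1)
    (U : Matrix (Fin n_c) (Fin d) ℝ)
    (hUorth : Uᵀ * U = 1)
    (hUcol : ∀ k, ∃ v : Fin n_t → ℝ, (X * H).mulVec v = fun i => U i k) :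
    ∀ j, ∑ i, ((U * Uᵀ * (X * H) + X * (1 - H) : Matrix (Fin n_c) (Fin n_t) ℝ)) i j = 1 := by
  have hX1 : (1 : Fin n_c → ℝ) ᵥ* X = 1 := by
    ext j
    simpa [Matrix.vecMul, dotProduct] using hX j
  have hH0 : (1 : Fin n_t → ℝ) ᵥ* H = 0 := hH ▸ one_vecMul_centering n_t hnt
  have hXH : (1 : Fin n_c → ℝ) ᵥ* (X * H) = 0 := by
    rw [← Matrix.vecMul_vecMul, hX1, hH0]
  have hU : (1 : Fin n_c → ℝ) ᵥ* U = 0 := vecMul_eq_zero_of_columns_mem_range hXH hUcol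
  have key : (1 : Fin n_c → ℝ) ᵥ* (U * Uᵀ * (X * H) + X * (1 - H)) = 1 := by
    rw [Matrix.vecMul_add, Matrix.mul_assoc, ← Matrix.vecMul_vecMul _ U, hU, Matrix.zero_vecMul,
      ← Matrix.vecMul_vecMul _ X, hX1, Matrix.vecMul_sub, hH0, Matrix.vecMul_one, sub_zero,
      zero_add]
  intro j
  simpa only [Matrix.vecMul, dotProduct, Pi.one_apply, one_mul] using congrFun key j
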